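/- Let (X,S,U,f) be a splitting structure on a complete metric space X satisfying condition (S5), and assume A_∞(B) = B for every closed ball B of X. Let φ : X → X be a bi-Lipschitz homeomorphism with constant K, and for a ball B = B(x,ρ) write Iφ(B) := B(φ(x), ρ/K). If a set E ⊆ X is ε₀-Cantor-winning on a ball B, then φ(E) is ε₀-Cantor-winning on Iφ(B). Moreover, if E is ε₀-Cantor-winning then so is its image φ(E). -/

import Mathlib

open scoped Classical
open Filter Set

/-- A closed (metric) ball in a metric space, recorded by its centre and its
(positive) radius. -/
structure SSBall (X : Type*) [MetricSpace X] where
  center : X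
  radius : ℝ
  radius_pos : 0 < radius

namespace SSBall

variable {X : Type*} [MetricSpace X]

/-- The underlying set of points of a ball. -/
def toSet (B : SSBall X) : Set X := Metric.closedBall B.center B.radius

end SSBall

/-- A splitting structure `(X, S, U, f)` on a metric space `X`:
`U ⊆ ℕ` is an infinite multiplicatively closed set of positive integers, closed under
division of its elements; `f` is completely multiplicative on `U`; and `S` splits every
closed ball `B` into `f u` closed sub-balls of radius `rad(B)/u` whose centres are
`2 rad(B)/u`-separated, compatibly with multiplication in `U`. -/
structure SplittingStructure (X : Type*) [MetricSpace X] where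
  U : Set ℕ
  f : ℕ → ℕ
  S : SSBall X → ℕ → Finset (SSBall X)
  U_pos : ∀ u ∈ U, 0 < u
  U_infinite : U.Infinite
  mul_mem : ∀ u ∈ U, ∀ v ∈ U, u * v ∈ U
  div_mem : ∀ u ∈ U, ∀ v ∈ U, u ∣ v → v / u ∈ U
  f_pos : ∀ u ∈ U, 0 < f u
  f_mul : ∀ u ∈ U, ∀ v ∈ U, f (u * v) = f u * f v
  S_subset : ∀ B : SSBall X, ∀ u ∈ U, ∀ b ∈ S B u, b.toSet ⊆ B.toSet
  S_radius : ∀ B : SSBall X, ∀ u ∈ U, ∀ b ∈ S B u, b.radius = B.radius / u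
  S_card : ∀ B : SSBall X, ∀ u ∈ U, (S B u).card = f u
  S_sep : ∀ B : SSBall X, ∀ u ∈ U, ∀ b₁ ∈ S B u, ∀ b₂ ∈ S B u,
    b₁ ≠ b₂ → 2 * B.radius / u ≤ dist b₁.center b₂.center
  S_comp : ∀ B : SSBall X, ∀ u ∈ U, ∀ v ∈ U,
    S B (u * v) = (S B u).biUnion fun b => S b v

namespace SplittingStructure

variable {X : Type*} [MetricSpace X]

/-- `A_u(B)`, the union of the balls of `S(B,u)`. -/
def Au (σ : SplittingStructure X) (B : SSBall X) (u : ℕ) : Set X :=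
  ⋃ b ∈ σ.S B u, b.toSet

/-- The limit set `A_∞(B)`.  (For any sequence `(u_i)` in `U` with `u_i ∣ u_{i+1}` and
`u_i → ∞` the intersection `⋂_i A_{u_i}(B)` is independent of the sequence and coincides
with the intersection of all the sets `A_u(B)`, `u ∈ U`.) -/
def Ainfty (σ : SplittingStructure X) (B : SSBall X) : Set X :=
  ⋂ u ∈ σ.U, σ.Au B u

/-- A splitting structure is nontrivial if `f` is not identically `1` on `U`. -/
def Nontrivial (σ : SplittingStructure X) : Prop := ∃ u ∈ σ.U, σ.f u ≠ 1

/-- `K` is a generalised `(B, ℛ, r)`-Cantor set for the splitting structure `σ`: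
it arises from the iterative construction that starts with `𝓑 0 = {B}`, and in which
`𝓑 (n+1)` is obtained from the collection of candidate balls
`I_{n+1} = ⋃_{B' ∈ 𝓑 n} S(B', R n)` by removing, for each `k = 0, …, n` and each ball
`B'' ∈ 𝓑 (n-k)`, at most `r (n-k) n` balls lying in `S(B'', R_{n-k} ⋯ R_n)`
(the balls removed at stage `k` form the collection `E k`). -/
def IsGenCantor (σ : SplittingStructure X) (B : SSBall X) (R : ℕ → ℕ)
    (r : ℕ → ℕ → ℝ) (K : Set X) : Prop :=
  ∃ 𝓑 : ℕ → Finset (SSBall X),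
    𝓑 0 = {B} ∧
    (∀ n : ℕ, ∃ E : ℕ → Finset (SSBall X),
      (∀ k ≤ n, E k ⊆ (𝓑 (n - k)).biUnion fun B'' =>
          σ.S B'' (∏ i ∈ Finset.range (k + 1), R (n - i))) ∧
      (∀ k ≤ n, ∀ B'' ∈ 𝓑 (n - k),
        ((E k ∩ σ.S B'' (∏ i ∈ Finset.range (k + 1), R (n - i))).card : ℝ)
          ≤ r (n - k) n) ∧
      𝓑 (n + 1) = ((𝓑 n).biUnion fun B' => σ.S B' (R n)) \
          (Finset.range (n + 1)).biUnion E) ∧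
    K = ⋂ n, ⋃ b ∈ 𝓑 n, b.toSet

/-- `E` is `ε₀`-Cantor-winning on the ball `B` for the splitting structure `σ`. -/
def CantorWinningOn (σ : SplittingStructure X) (ε₀ : ℝ) (B : SSBall X)
    (E : Set X) : Prop :=
  ∀ ε : ℝ, 0 < ε → ε < ε₀ → ∃ Rε ∈ σ.U, ∀ R ∈ σ.U, Rε ≤ R →
    ∃ K : Set X,
      σ.IsGenCantor B (fun _ => R)
        (fun m n => (σ.f R : ℝ) ^ (((n : ℝ) - (m : ℝ) + 1) * (1 - ε))) K ∧
      K ⊆ E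

/-- `E` is `ε₀`-Cantor-winning for `σ` if it is `ε₀`-Cantor-winning on every ball. -/
def CantorWinning (σ : SplittingStructure X) (ε₀ : ℝ) (E : Set X) : Prop :=
  ∀ B : SSBall X, σ.CantorWinningOn ε₀ B E

end SplittingStructure

/-- Condition (S4) with an explicit constant `C`: no closed ball of `X` intersects more
than `C` pairwise disjoint open balls of the same radius as itself. -/
def CondS4With (X : Type*) [MetricSpace X] (C : ℕ) : Prop :=
  ∀ (x : X) (ρ : ℝ), 0 < ρ → ∀ T : Finset X,
    (∀ y ∈ T, (Metric.ball y ρ ∩ Metric.closedBall x ρ).Nonempty) →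
    (T : Set X).PairwiseDisjoint (fun y => Metric.ball y ρ) →
    T.card ≤ C

/-- Condition (S4). -/
def CondS4 (X : Type*) [MetricSpace X] : Prop := ∃ C : ℕ, CondS4With X C

/-- Condition (S5): for each `K > 1` there is a constant `C(K,X)` such that no ball of
radius `K·ρ` intersects more than `C(K,X)` pairwise disjoint open balls of radius `ρ`. -/
def CondS5 (X : Type*) [MetricSpace X] : Prop :=
  ∀ K : ℝ, 1 < K → ∃ C : ℕ, ∀ (x : X) (ρ : ℝ), 0 < ρ → ∀ T : Finset X,
    (∀ y ∈ T, (Metric.ball y ρ ∩ Metric.closedBall x (K * ρ)).Nonempty) →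
    (T : Set X).PairwiseDisjoint (fun y => Metric.ball y ρ) →
    T.card ≤ C

lemma CondS5.card_le_of_separated {X : Type*} [MetricSpace X] {L : ℝ} {C : ℕ}
    (hC : ∀ (x : X) (ρ : ℝ), 0 < ρ → ∀ T : Finset X,
      (∀ y ∈ T, (Metric.ball y ρ ∩ Metric.closedBall x (L * ρ)).Nonempty) →
      (T : Set X).PairwiseDisjoint (fun y => Metric.ball y ρ) → T.card ≤ C)
    {T : Finset (SSBall X)} {s : ℝ} (hs : 0 < s) (x : X)
    (hsep : ∀ b₁ ∈ T, ∀ b₂ ∈ T, b₁ ≠ b₂ → 2 * s ≤ dist b₁.center b₂.center)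
    (hx : ∀ b ∈ T, dist b.center x ≤ L * s) : T.card ≤ C := by
  have hinj : Set.InjOn SSBall.center (T : Set (SSBall X)) := by
    intro b₁ h₁ b₂ h₂ h
    by_contra hne
    have := hsep b₁ h₁ b₂ h₂ hne
    rw [h, dist_self] at this
    linarith
  rw [← Finset.card_image_of_injOn hinj]
  refine hC x s hs _ ?_ ?_
  · intro y hy
    obtain ⟨b, hb, rfl⟩ := Finset.mem_image.1 hy
    exact ⟨b.center, Metric.mem_ball_self hs, Metric.mem_closedBall.2 (hx b hb)⟩
  · intro y₁ hy₁ y₂ hy₂ hne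
    obtain ⟨b₁, h₁, rfl⟩ := Finset.mem_image.1 (Finset.mem_coe.1 hy₁)
    obtain ⟨b₂, h₂, rfl⟩ := Finset.mem_image.1 (Finset.mem_coe.1 hy₂)
    refine Metric.ball_disjoint_ball ?_
    have := hsep b₁ h₁ b₂ h₂ (fun h => hne (by rw [h]))
    linarith

namespace SplittingStructure

variable {X : Type*} [MetricSpace X]

lemma pow_succ_mem (σ : SplittingStructure X) {u : ℕ} (hu : u ∈ σ.U) (n : ℕ) :
    u ^ (n + 1) ∈ σ.U := by
  induction n with
  | zero => simpa using hu
  | succ n ih => rw [pow_succ]; exact σ.mul_mem _ ih _ hu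

lemma f_pow_succ (σ : SplittingStructure X) {u : ℕ} (hu : u ∈ σ.U) (n : ℕ) :
    σ.f (u ^ (n + 1)) = σ.f u ^ (n + 1) := by
  induction n with
  | zero => simp
  | succ n ih => rw [pow_succ, σ.f_mul _ (σ.pow_succ_mem hu n) _ hu, ih, ← pow_succ]

lemma exists_mem_S_of_mem (σ : SplittingStructure X)
    (hA : ∀ B : SSBall X, σ.Ainfty B = B.toSet) {B : SSBall X} {u : ℕ} (hu : u ∈ σ.U)
    {x : X} (hx : x ∈ B.toSet) : ∃ b ∈ σ.S B u, x ∈ b.toSet := by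
  rw [← hA B] at hx
  simpa [Au] using Set.mem_iInter₂.1 hx u hu

lemma f_le_f_of_lt (σ : SplittingStructure X)
    (hA : ∀ B : SSBall X, σ.Ainfty B = B.toSet) (B : SSBall X) {v R : ℕ} (hv : v ∈ σ.U)
    (hR : R ∈ σ.U) (hvR : v < R) : σ.f v ≤ σ.f R := by
  have hcov : ∀ c : SSBall X, ∃ b, c ∈ σ.S B v → b ∈ σ.S B R ∧ c.center ∈ b.toSet := by
    intro c
    by_cases hc : c ∈ σ.S B v
    · obtain ⟨b, hb, hcb⟩ := σ.exists_mem_S_of_mem hA hR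
        (σ.S_subset B v hv c hc (Metric.mem_closedBall_self c.radius_pos.le))
      exact ⟨b, fun _ => ⟨hb, hcb⟩⟩
    · exact ⟨c, fun h => absurd h hc⟩
  choose g hg using hcov
  rw [← σ.S_card B v hv, ← σ.S_card B R hR]
  refine Finset.card_le_card_of_injOn g (fun c hc => (hg c hc).1) ?_
  intro c₁ h₁ c₂ h₂ h
  by_contra hne
  have hsep := σ.S_sep B v hv c₁ h₁ c₂ h₂ hne
  have d₁ := Metric.mem_closedBall.1 (hg c₁ h₁).2
  have d₂ := Metric.mem_closedBall.1 (hg c₂ h₂).2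
  rw [h] at d₁
  rw [σ.S_radius B R hR _ (hg c₂ h₂).1] at d₁ d₂
  have hlt : B.radius / R < B.radius / v :=
    div_lt_div_of_pos_left B.radius_pos (by exact_mod_cast σ.U_pos v hv)
      (by exact_mod_cast hvR)
  have := dist_triangle_right c₁.center c₂.center (g c₂).center
  rw [mul_div_assoc] at hsep
  linarith

lemma exists_forall_le_f (σ : SplittingStructure X)
    (hA : ∀ B : SSBall X, σ.Ainfty B = B.toSet) (hσ : σ.Nontrivial) (B : SSBall X) (M : ℕ) :
    ∃ N : ℕ, ∀ R ∈ σ.U, N ≤ R → M ≤ σ.f R := by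
  obtain ⟨u, hu, hfu⟩ := hσ
  have h2 : 1 < σ.f u := by have := σ.f_pos u hu; omega
  refine ⟨u ^ (M + 1) + 1, fun R hR hNR => ?_⟩
  have h := σ.f_le_f_of_lt hA B (σ.pow_succ_mem hu M) hR hNR
  rw [σ.f_pow_succ hu] at h
  have := Nat.lt_pow_self h2 (n := M + 1)
  omega

/-- If `f` is identically `1`, removing the single candidate ball yields an empty generalised
Cantor set. -/
lemma cantorWinningOn_of_not_nontrivial (σ : SplittingStructure X) (hσ : ¬ σ.Nontrivial)
    (ε₀ : ℝ) (B : SSBall X) (E : Set X) : σ.CantorWinningOn ε₀ B E := by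
  have hf : ∀ u ∈ σ.U, σ.f u = 1 := by simpa [Nontrivial] using hσ
  intro ε _ _
  obtain ⟨u, hu⟩ := σ.U_infinite.nonempty
  refine ⟨u, hu, fun R hR _ => ⟨∅, ⟨fun n => if n = 0 then {B} else ∅, by simp, ?_, ?_⟩,
    Set.empty_subset E⟩⟩
  · intro n
    rcases Nat.eq_zero_or_pos n with rfl | hn
    · exact ⟨fun _ => σ.S B R, by simp, by simp [σ.S_card B R hR, hf R hR], by simp⟩
    · refine ⟨fun _ => ∅, by simp, ?_, by simp [hn.ne']⟩
      intro k _ _ _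
      simp only [Finset.empty_inter, Finset.card_empty, Nat.cast_zero]
      positivity
  · refine (Set.eq_empty_of_forall_notMem fun x hx => ?_).symm
    simpa using Set.mem_iInter.1 hx 1

section Chain

variable {σ : SplittingStructure X} {B : SSBall X} {R : ℕ} {𝓑 : ℕ → Finset (SSBall X)}

lemma exists_mem_S_pow_of_chain (hR : R ∈ σ.U)
    (h : ∀ n, 𝓑 (n + 1) ⊆ (𝓑 n).biUnion fun b => σ.S b R) (m k : ℕ) :
    ((𝓑 (m + k)).biUnion fun b => σ.S b R) ⊆
      (𝓑 m).biUnion fun b => σ.S b (R ^ (k + 1)) := by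
  induction k with
  | zero => simp
  | succ k ih =>
    intro b hb
    obtain ⟨b', hb', hbb'⟩ := Finset.mem_biUnion.1 hb
    obtain ⟨b'', hb'', hbb''⟩ := Finset.mem_biUnion.1 (ih (h (m + k) hb'))
    refine Finset.mem_biUnion.2 ⟨b'', hb'', ?_⟩
    rw [pow_succ, σ.S_comp _ _ (σ.pow_succ_mem hR k) _ hR]
    exact Finset.mem_biUnion.2 ⟨b', hbb'', hbb'⟩

lemma mem_S_pow_of_chain (hR : R ∈ σ.U) (h0 : 𝓑 0 = {B})
    (h : ∀ n, 𝓑 (n + 1) ⊆ (𝓑 n).biUnion fun b => σ.S b R) {n : ℕ} :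
    𝓑 (n + 1) ⊆ σ.S B (R ^ (n + 1)) := by
  have := (h n).trans (by simpa using exists_mem_S_pow_of_chain hR h 0 n)
  simpa [h0] using this

lemma radius_of_chain (hR : R ∈ σ.U) (h0 : 𝓑 0 = {B})
    (h : ∀ n, 𝓑 (n + 1) ⊆ (𝓑 n).biUnion fun b => σ.S b R) {n : ℕ} {b : SSBall X}
    (hb : b ∈ 𝓑 n) : b.radius = B.radius / (R : ℝ) ^ n := by
  cases n with
  | zero =>
    rw [h0, Finset.mem_singleton] at hb
    simp [hb]
  | succ n =>
    simpa using σ.S_radius B _ (σ.pow_succ_mem hR n) b (mem_S_pow_of_chain hR h0 h hb)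

lemma separated_of_chain (hR : R ∈ σ.U) (h0 : 𝓑 0 = {B})
    (h : ∀ n, 𝓑 (n + 1) ⊆ (𝓑 n).biUnion fun b => σ.S b R) {n : ℕ} {b₁ b₂ : SSBall X}
    (h₁ : b₁ ∈ 𝓑 n) (h₂ : b₂ ∈ 𝓑 n) (hne : b₁ ≠ b₂) :
    2 * (B.radius / (R : ℝ) ^ n) ≤ dist b₁.center b₂.center := by
  cases n with
  | zero =>
    rw [h0, Finset.mem_singleton] at h₁ h₂
    exact absurd (h₁.trans h₂.symm) hne
  | succ n =>
    simpa [mul_div_assoc] using σ.S_sep B _ (σ.pow_succ_mem hR n) b₁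
      (mem_S_pow_of_chain hR h0 h h₁) b₂ (mem_S_pow_of_chain hR h0 h h₂) hne

end Chain

/-- The balls obtained from `D` by repeatedly splitting by `R` and keeping, after `n + 1` steps,
those disjoint from the images under `φ` of all balls in `E n k`, `k ≤ n`. -/
noncomputable def survivors (σ : SplittingStructure X) (φ : X → X) (D : SSBall X) (R : ℕ)
    (E : ℕ → ℕ → Finset (SSBall X)) : ℕ → Finset (SSBall X)
  | 0 => {D}
  | n + 1 => ((survivors σ φ D R E n).biUnion fun b => σ.S b R).filter fun b =>
      ∀ k ≤ n, ∀ e ∈ E n k, Disjoint b.toSet (φ '' e.toSet)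

/-- The generalised Cantor set obtained by transporting removed balls through a bi-Lipschitz map;
removal bounds deteriorate only by a constant depending on `K` and the space. -/
lemma IsGenCantor.image_biLipschitz {σ : SplittingStructure X}
    (hA : ∀ B : SSBall X, σ.Ainfty B = B.toSet)
    {φ : X → X} (hsurj : Function.Surjective φ) {K : ℝ} (hK : 0 < K)
    (hlip : ∀ x₁ x₂ : X, K⁻¹ * dist x₁ x₂ ≤ dist (φ x₁) (φ x₂) ∧
      dist (φ x₁) (φ x₂) ≤ K * dist x₁ x₂)
    {C₁ C₂ : ℕ}
    (hC₁ : ∀ (x : X) (ρ : ℝ), 0 < ρ → ∀ T : Finset X,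
      (∀ y ∈ T, (Metric.ball y ρ ∩ Metric.closedBall x (2 * ρ)).Nonempty) →
      (T : Set X).PairwiseDisjoint (fun y => Metric.ball y ρ) → T.card ≤ C₁)
    (hC₂ : ∀ (x : X) (ρ : ℝ), 0 < ρ → ∀ T : Finset X,
      (∀ y ∈ T, (Metric.ball y ρ ∩ Metric.closedBall x ((K ^ 2 + 1) * ρ)).Nonempty) →
      (T : Set X).PairwiseDisjoint (fun y => Metric.ball y ρ) → T.card ≤ C₂)
    {B : SSBall X} {R : ℕ} (hR : R ∈ σ.U) {r r' : ℕ → ℕ → ℝ}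
    (hr0 : ∀ m n, 0 ≤ r m n)
    (hr : ∀ m n, m ≤ n → (C₁ * C₂ : ℕ) * r m n ≤ r' m n) {Z : Set X}
    (hZ : σ.IsGenCantor B (fun _ => R) r Z) :
    ∃ Z' : Set X, σ.IsGenCantor ⟨φ B.center, B.radius / K, div_pos B.radius_pos hK⟩
      (fun _ => R) r' Z' ∧ Z' ⊆ φ '' Z := by
  obtain ⟨𝓑, h𝓑0, hstep, rfl⟩ := hZ
  choose E hEsub hEcard h𝓑 using hstep
  simp only [Finset.prod_const, Finset.card_range] at hEsub hEcard
  have h𝓑c : ∀ n, 𝓑 (n + 1) ⊆ (𝓑 n).biUnion fun b => σ.S b R := fun n => by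
    rw [h𝓑 n]; exact Finset.sdiff_subset
  set D : SSBall X := ⟨φ B.center, B.radius / K, div_pos B.radius_pos hK⟩ with hD
  set 𝓒 := survivors σ φ D R E
  have h𝓒0 : 𝓒 0 = {D} := rfl
  have h𝓒s : ∀ n, 𝓒 (n + 1) = ((𝓒 n).biUnion fun b => σ.S b R).filter fun b =>
      ∀ k ≤ n, ∀ e ∈ E n k, Disjoint b.toSet (φ '' e.toSet) := fun n => rfl
  have h𝓒c : ∀ n, 𝓒 (n + 1) ⊆ (𝓒 n).biUnion fun b => σ.S b R := fun n => by
    rw [h𝓒s n]; exact Finset.filter_subset _ _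
  have hRpos : (0 : ℝ) < R := by exact_mod_cast σ.U_pos R hR
  have hdist : ∀ x y, dist x y ≤ K * dist (φ x) (φ y) := fun x y => by
    have := (hlip x y).1
    rwa [inv_mul_le_iff₀ hK] at this
  refine ⟨⋂ n, ⋃ b ∈ 𝓒 n, b.toSet, ⟨𝓒, h𝓒0, fun n => ?_, rfl⟩, ?_⟩
  · refine ⟨fun k => ((𝓒 n).biUnion fun b => σ.S b R).filter fun b =>
      ∃ e ∈ E n k, ¬ Disjoint b.toSet (φ '' e.toSet), ?_, ?_, ?_⟩
    · intro k hk
      simp only [Finset.prod_const, Finset.card_range]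
      refine (Finset.filter_subset _ _).trans ?_
      have := exists_mem_S_pow_of_chain hR h𝓒c (n - k) k
      rwa [Nat.sub_add_cancel hk] at this
    · intro k hk D' hD'
      simp only [Finset.prod_const, Finset.card_range]
      refine le_trans ?_ (hr (n - k) n (Nat.sub_le n k))
      have hDrad := radius_of_chain hR h𝓒0 h𝓒c hD'
      obtain ⟨x₀, hx₀⟩ := hsurj D'.center
      set ρ : ℝ := B.radius / (R : ℝ) ^ (n - k) with hρ
      have hρpos : 0 < ρ := div_pos B.radius_pos (by positivity)
      have hDρ : D'.radius = ρ / K := by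
        rw [hDrad, hD, hρ]; simp only; rw [div_right_comm]
      have hRk : (0 : ℝ) < (R : ℝ) ^ (k + 1) := by positivity
      set near := (𝓑 (n - k)).filter fun b => dist b.center x₀ ≤ 2 * ρ
      have hnear_card : near.card ≤ C₁ := by
        refine CondS5.card_le_of_separated hC₁ hρpos x₀ ?_ ?_
        · intro b₁ h₁ b₂ h₂ hne
          exact separated_of_chain hR h𝓑0 h𝓑c (Finset.mem_filter.1 h₁).1
            (Finset.mem_filter.1 h₂).1 hne
        · exact fun b hb => (Finset.mem_filter.1 hb).2
      set T : SSBall X → Finset (SSBall X) := fun e =>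
        (σ.S D' (R ^ (k + 1))).filter fun b => ¬ Disjoint b.toSet (φ '' e.toSet)
      have hcover : (((𝓒 n).biUnion fun b => σ.S b R).filter fun b =>
          ∃ e ∈ E n k, ¬ Disjoint b.toSet (φ '' e.toSet)) ∩ σ.S D' (R ^ (k + 1)) ⊆
          near.biUnion fun b'' => (E n k ∩ σ.S b'' (R ^ (k + 1))).biUnion T := by
        intro b hb
        obtain ⟨hb, hbD⟩ := Finset.mem_inter.1 hb
        obtain ⟨-, e, he, hbe⟩ := Finset.mem_filter.1 hb
        obtain ⟨b'', hb'', heb⟩ := Finset.mem_biUnion.1 (hEsub n k hk he)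
        refine Finset.mem_biUnion.2 ⟨b'', Finset.mem_filter.2 ⟨hb'', ?_⟩,
          Finset.mem_biUnion.2 ⟨e, Finset.mem_inter.2 ⟨he, heb⟩,
            Finset.mem_filter.2 ⟨hbD, hbe⟩⟩⟩
        obtain ⟨_, hyb, y, hye, rfl⟩ := Set.not_disjoint_iff.1 hbe
        have h₁ := Metric.mem_closedBall.1
          (σ.S_subset _ _ (σ.pow_succ_mem hR k) _ hbD hyb)
        have h₂ := Metric.mem_closedBall.1
          (σ.S_subset _ _ (σ.pow_succ_mem hR k) _ heb hye)
        rw [radius_of_chain hR h𝓑0 h𝓑c hb''] at h₂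
        rw [hDρ, ← hx₀] at h₁
        have h₃ := (hdist y x₀).trans (mul_le_mul_of_nonneg_left h₁ hK.le)
        rw [mul_div_cancel₀ _ hK.ne'] at h₃
        have := dist_triangle_left b''.center x₀ y
        linarith
      have hT_card : ∀ b'' ∈ near, ∀ e ∈ E n k ∩ σ.S b'' (R ^ (k + 1)),
          (T e).card ≤ C₂ := by
        intro b'' hb'' e he
        have hs : 0 < D'.radius / (R : ℝ) ^ (k + 1) := div_pos D'.radius_pos hRk
        have herad : e.radius = K * (D'.radius / (R : ℝ) ^ (k + 1)) := by
          rw [σ.S_radius _ _ (σ.pow_succ_mem hR k) _ (Finset.mem_inter.1 he).2,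
            radius_of_chain hR h𝓑0 h𝓑c (Finset.mem_filter.1 hb'').1, hDρ, hρ]
          push_cast
          field_simp
        refine CondS5.card_le_of_separated hC₂ hs (φ e.center) ?_ ?_
        · intro b₁ h₁ b₂ h₂ hne
          simpa [mul_div_assoc] using σ.S_sep D' _ (σ.pow_succ_mem hR k) b₁
            (Finset.mem_filter.1 h₁).1 b₂ (Finset.mem_filter.1 h₂).1 hne
        · intro b hb
          obtain ⟨hbD, hbe⟩ := Finset.mem_filter.1 hb
          obtain ⟨_, hyb, y, hye, rfl⟩ := Set.not_disjoint_iff.1 hbe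
          have h₁ := Metric.mem_closedBall.1 hyb
          have h₂ := Metric.mem_closedBall.1 hye
          rw [σ.S_radius _ _ (σ.pow_succ_mem hR k) _ hbD] at h₁
          push_cast at h₁
          rw [herad] at h₂
          have h₃ := (hlip y e.center).2.trans (mul_le_mul_of_nonneg_left h₂ hK.le)
          have := dist_triangle_left b.center (φ e.center) (φ y)
          linarith
      calc _ ≤ ((near.biUnion fun b'' =>
              (E n k ∩ σ.S b'' (R ^ (k + 1))).biUnion T).card : ℝ) := by
            exact_mod_cast Finset.card_le_card hcover
        _ ≤ ∑ b'' ∈ near, (((E n k ∩ σ.S b'' (R ^ (k + 1))).biUnion T).card : ℝ) := by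
            exact_mod_cast Finset.card_biUnion_le
        _ ≤ ∑ b'' ∈ near, (C₂ : ℝ) * r (n - k) n := by
            refine Finset.sum_le_sum fun b'' hb'' => ?_
            have h₁ := Finset.card_biUnion_le_card_mul _ _ _ (hT_card b'' hb'')
            calc _ ≤ (((E n k ∩ σ.S b'' (R ^ (k + 1))).card * C₂ : ℕ) : ℝ) := by
                  exact_mod_cast h₁
              _ = (C₂ : ℝ) * ((E n k ∩ σ.S b'' (R ^ (k + 1))).card : ℝ) := by
                  push_cast; ring
              _ ≤ _ := mul_le_mul_of_nonneg_left
                  (hEcard n k hk b'' (Finset.mem_filter.1 hb'').1) (Nat.cast_nonneg _)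
        _ ≤ _ := by
            rw [Finset.sum_const, nsmul_eq_mul]
            have := hr0 (n - k) n
            push_cast
            rw [mul_assoc]
            gcongr
    · rw [h𝓒s n]
      ext b
      simp only [Finset.mem_filter, Finset.mem_sdiff, Finset.mem_biUnion, Finset.mem_range,
        Nat.lt_succ_iff, not_exists, not_and, not_not]
      exact ⟨fun h => ⟨h.1, fun k hk _ e he => h.2 k hk e he⟩,
        fun h => ⟨h.1, fun k hk e he => h.2 k hk h.1 e he⟩⟩
  · intro y hy
    obtain ⟨x, rfl⟩ := hsurj y
    refine ⟨x, Set.mem_iInter.2 fun n => ?_, rfl⟩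
    induction n with
    | zero =>
      have h₁ : φ x ∈ D.toSet := by simpa [h𝓒0] using Set.mem_iInter.1 hy 0
      have h₂ := (hdist x B.center).trans
        (mul_le_mul_of_nonneg_left (Metric.mem_closedBall.1 h₁) hK.le)
      rw [hD, mul_div_cancel₀ _ hK.ne'] at h₂
      have h₃ : x ∈ B.toSet := Metric.mem_closedBall.2 h₂
      simpa [h𝓑0] using h₃
    | succ n ih =>
      obtain ⟨b, hb, hxb⟩ := Set.mem_iUnion₂.1 ih
      obtain ⟨b', hb', hxb'⟩ := σ.exists_mem_S_of_mem hA hR hxb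
      refine Set.mem_iUnion₂.2 ⟨b', ?_, hxb'⟩
      rw [h𝓑 n, Finset.mem_sdiff]
      refine ⟨Finset.mem_biUnion.2 ⟨b, hb, hb'⟩, fun hrem => ?_⟩
      obtain ⟨k, hk, hbk⟩ := Finset.mem_biUnion.1 hrem
      obtain ⟨c, hc, hyc⟩ := Set.mem_iUnion₂.1 (Set.mem_iInter.1 hy (n + 1))
      rw [h𝓒s n] at hc
      exact Set.disjoint_left.1
        ((Finset.mem_filter.1 hc).2 k (Nat.lt_succ_iff.1 (Finset.mem_range.1 hk)) b' hbk)
        hyc (Set.mem_image_of_mem φ hxb')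

end SplittingStructure

lemma mul_rpow_le_rpow_of_le {C F ε ε' t : ℝ} (hF : 1 ≤ F) (hε : ε < ε') (ht : 1 ≤ t)
    (hC : C ≤ F ^ (ε' - ε)) : C * F ^ (t * (1 - ε')) ≤ F ^ (t * (1 - ε)) := by
  have hF0 : 0 < F := by linarith
  calc C * F ^ (t * (1 - ε')) ≤ F ^ (t * (ε' - ε)) * F ^ (t * (1 - ε')) := by
        refine mul_le_mul_of_nonneg_right (hC.trans ?_) (Real.rpow_nonneg hF0.le _)
        exact Real.rpow_le_rpow_of_exponent_le hF (by nlinarith)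
    _ = F ^ (t * (1 - ε)) := by rw [← Real.rpow_add hF0]; ring_nf

/-- Suppose `X` satisfies condition (S5) and `A_∞(B) = B` for every
ball `B`, and let `φ : X → X` be a bi-Lipschitz homeomorphism with constant `K`.  If a
set `E` is `ε₀`-Cantor-winning on a ball `B`, then `φ(E)` is `ε₀`-Cantor-winning on the
inscribed ball `Iφ(B) = B(φ(cent B), rad B / K)`; moreover, if `E` is
`ε₀`-Cantor-winning then so is `φ(E)`. -/
theorem cantorWinning_image_biLipschitz {X : Type*} [MetricSpace X] [CompleteSpace X]
    (σ : SplittingStructure X) (hS5 : CondS5 X)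
    (hA : ∀ B : SSBall X, σ.Ainfty B = B.toSet)
    (φ : X → X) (hbij : Function.Bijective φ)
    (K : ℝ) (hK : 0 < K)
    (hlip : ∀ x₁ x₂ : X, K⁻¹ * dist x₁ x₂ ≤ dist (φ x₁) (φ x₂) ∧
      dist (φ x₁) (φ x₂) ≤ K * dist x₁ x₂)
    (ε₀ : ℝ) (hε₀ : 0 < ε₀) :
    (∀ (B : SSBall X) (E : Set X), σ.CantorWinningOn ε₀ B E →
      σ.CantorWinningOn ε₀ ⟨φ B.center, B.radius / K, div_pos B.radius_pos hK⟩
        (φ '' E)) ∧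
    (∀ E : Set X, σ.CantorWinning ε₀ E → σ.CantorWinning ε₀ (φ '' E)) := by
  have main : ∀ (B : SSBall X) (E : Set X), σ.CantorWinningOn ε₀ B E →
      σ.CantorWinningOn ε₀ ⟨φ B.center, B.radius / K, div_pos B.radius_pos hK⟩
        (φ '' E) := by
    intro B E hE
    by_cases hσ : σ.Nontrivial
    swap
    · exact σ.cantorWinningOn_of_not_nontrivial hσ _ _ _
    obtain ⟨C₁, hC₁⟩ := hS5 2 one_lt_two
    obtain ⟨C₂, hC₂⟩ := hS5 (K ^ 2 + 1) (by nlinarith [pow_pos hK 2])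
    intro ε hε hεε₀
    obtain ⟨ε', hεε', hε'ε₀⟩ := exists_between hεε₀
    obtain ⟨R₀, -, hR₀⟩ := hE ε' (hε.trans hεε') hε'ε₀
    have hδ : 0 < ε' - ε := sub_pos.2 hεε'
    obtain ⟨N, hN⟩ := σ.exists_forall_le_f hA hσ B
      ⌈((C₁ * C₂ : ℕ) : ℝ) ^ (ε' - ε)⁻¹⌉₊
    obtain ⟨Rε, hRε, hlt⟩ := σ.U_infinite.exists_gt (max R₀ N)
    refine ⟨Rε, hRε, fun R hR hle => ?_⟩
    obtain ⟨Z, hZ, hZE⟩ := hR₀ R hR ((le_max_left _ _).trans (hlt.le.trans hle))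
    have hF : (1 : ℝ) ≤ σ.f R := by exact_mod_cast σ.f_pos R hR
    have hCF : ((C₁ * C₂ : ℕ) : ℝ) ≤ (σ.f R : ℝ) ^ (ε' - ε) := by
      rw [← Real.rpow_inv_le_iff_of_pos (Nat.cast_nonneg _) (by linarith) hδ]
      exact Nat.ceil_le.1 (hN R hR ((le_max_right _ _).trans (hlt.le.trans hle)))
    obtain ⟨Z', hZ', hsub⟩ := hZ.image_biLipschitz (r' := fun m n =>
      (σ.f R : ℝ) ^ (((n : ℝ) - (m : ℝ) + 1) * (1 - ε))) hA hbij.surjective hK hlip hC₁ hC₂ hR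
      (fun _ _ => by positivity)
      (fun m n hmn => mul_rpow_le_rpow_of_le hF hεε'
        (by have : (m : ℝ) ≤ n := by exact_mod_cast hmn
            linarith) hCF)
    exact ⟨Z', hZ', hsub.trans (Set.image_mono hZE)⟩
  refine ⟨main, fun E hE D => ?_⟩
  obtain ⟨x, hx⟩ := hbij.surjective D.center
  have h := main ⟨x, K * D.radius, mul_pos hK D.radius_pos⟩ E (hE _)
  simpa only [hx, mul_div_cancel_left₀ _ hK.ne'] using h
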